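/- In ℚ[x,y,z], let Ñ be the 3×3 matrix ½·[(−x, 4z, −xy+108yz²); (3y, 4x, −y²−64z³); (16z, −4y, 4x²−4yz−320xz²)] and let W = −80x³ + 81y³ + 176xyz + 256z³. Then −½·det Ñ = (yz−x²)² − xy³ + W·z². In particular, for the matrices M̃ = ½·[(8z², y, −x, 0); (y, −32z, −9y, 8x); (−x, −9y, 10x, 8z); (0, 8x, 8z, −8y)] and Ñ one has ¼·det M̃ = −½·det Ñ. -/

import Mathlib

open MvPolynomial Matrix

namespace Stmt15

noncomputable section

def x : MvPolynomial (Fin 3) ℚ := X 0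
def y : MvPolynomial (Fin 3) ℚ := X 1
def z : MvPolynomial (Fin 3) ℚ := X 2

/-- The perturbed syzygy matrix `Ñ`, one half times the displayed matrix. -/
def Nt : Matrix (Fin 3) (Fin 3) (MvPolynomial (Fin 3) ℚ) :=
  (C (1 / 2 : ℚ) : MvPolynomial (Fin 3) ℚ) •
    !![-x, 4 * z, -(x * y) + 108 * y * z ^ 2;
       3 * y, 4 * x, -(y ^ 2) - 64 * z ^ 3;
       16 * z, -4 * y, 4 * x ^ 2 - 4 * y * z - 320 * x * z ^ 2]

/-- The perturbed matrix `M̃`, one half times the displayed matrix. -/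
def Mt : Matrix (Fin 4) (Fin 4) (MvPolynomial (Fin 3) ℚ) :=
  (C (1 / 2 : ℚ) : MvPolynomial (Fin 3) ℚ) •
    !![8 * z ^ 2, y, -x, 0;
       y, -32 * z, -9 * y, 8 * x;
       -x, -9 * y, 10 * x, 8 * z;
       0, 8 * x, 8 * z, -8 * y]

/-- The cubic `W` cutting out four times the divisor `D`. -/
def W : MvPolynomial (Fin 3) ℚ :=
  -80 * x ^ 3 + 81 * y ^ 3 + 176 * x * y * z + 256 * z ^ 3

section Determinants

variable {R : Type*} [CommRing R] (a b c : R)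

lemma det_syzygy_matrix :
    (!![-a, 4 * c, -(a * b) + 108 * b * c ^ 2;
        3 * b, 4 * a, -(b ^ 2) - 64 * c ^ 3;
        16 * c, -4 * b, 4 * a ^ 2 - 4 * b * c - 320 * a * c ^ 2]).det =
      -16 * ((b * c - a ^ 2) ^ 2 - a * b ^ 3 +
        (-80 * a ^ 3 + 81 * b ^ 3 + 176 * a * b * c + 256 * c ^ 3) * c ^ 2) := by
  simp [det_fin_three]
  ring

lemma det_symmetric_matrix :
    (!![8 * c ^ 2, b, -a, 0;
        b, -32 * c, -9 * b, 8 * a;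
        -a, -9 * b, 10 * a, 8 * c;
        0, 8 * a, 8 * c, -8 * b]).det =
      64 * ((b * c - a ^ 2) ^ 2 - a * b ^ 3 +
        (-80 * a ^ 3 + 81 * b ^ 3 + 176 * a * b * c + 256 * c ^ 3) * c ^ 2) := by
  simp [det_succ_row_zero, Fin.sum_univ_succ, Fin.succAbove]
  ring

end Determinants

/-- `−½·det Ñ = (yz−x²)² − xy³ + W·z²`, and in particular `¼·det M̃ = −½·det Ñ`. -/
theorem stmt15 :
    -(C (1 / 2 : ℚ) * Nt.det) = (y * z - x ^ 2) ^ 2 - x * y ^ 3 + W * z ^ 2 ∧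
    C (1 / 4 : ℚ) * Mt.det = -(C (1 / 2 : ℚ) * Nt.det) := by
  have hN : Nt.det = C (1 / 2 : ℚ) ^ 3 *
      (-16 * ((y * z - x ^ 2) ^ 2 - x * y ^ 3 + W * z ^ 2)) := by
    rw [Nt, det_smul, Fintype.card_fin, det_syzygy_matrix, W]
  have hM : Mt.det = C (1 / 2 : ℚ) ^ 4 *
      (64 * ((y * z - x ^ 2) ^ 2 - x * y ^ 3 + W * z ^ 2)) := by
    rw [Mt, det_smul, Fintype.card_fin, det_symmetric_matrix, W]
  have hquarter : (C (1 / 4 : ℚ) : MvPolynomial (Fin 3) ℚ) = C (1 / 2) ^ 2 := by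
    rw [← C_pow]
    norm_num
  have hhalf : (C (1 / 2 : ℚ) : MvPolynomial (Fin 3) ℚ) * 2 = 1 := by
    rw [← map_ofNat (C : ℚ →+* MvPolynomial (Fin 3) ℚ) 2, ← C_mul]
    norm_num
  rw [hN, hM, hquarter]
  generalize (C (1 / 2 : ℚ) : MvPolynomial (Fin 3) ℚ) = c at hhalf ⊢
  have hpow_four : c ^ 4 * 16 = 1 := by
    linear_combination (8 * c ^ 3 + 4 * c ^ 2 + 2 * c + 1) * hhalf
  have hpow_six : c ^ 6 * 64 = 1 := by
    linear_combination 4 * c ^ 2 * hpow_four + (2 * c + 1) * hhalf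
  constructor
  · linear_combination ((y * z - x ^ 2) ^ 2 - x * y ^ 3 + W * z ^ 2) * hpow_four
  · linear_combination
      ((y * z - x ^ 2) ^ 2 - x * y ^ 3 + W * z ^ 2) * (hpow_six - hpow_four)

end

end Stmt15
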